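/- Let E ⊊ K be a proper pair of algebraically closed fields, k ⊆ L subfields of K, and a a finite tuple from K. If the field k(a) and the compositum E·L are algebraically free over the compositum E·k, then λ(L(a)) and λ(k(a)) are interalgebraic over λ(L): every element of λ(L(a)) is algebraic over the compositum λ(L)·λ(k(a)) (and λ(k(a)) ⊆ λ(L(a))). -/

import Mathlib

open MvPolynomial

/-- The set of λ-values of a subfield `k` of `K` (with respect to the subfield `E`):
all `e ∈ E` for which there are `a₀, a₁, …, a_n ∈ k` (`n ≥ 1`) with `a₁, …, a_n`
linearly independent over `E`, and `e₁, …, e_n ∈ E` with `a₀ = e₁ a₁ + ⋯ + e_n a_n`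
and `e = e₁`. -/
def lambdaSet {K : Type*} [Field K] (E k : Subfield K) : Set K :=
  {e | ∃ (n : ℕ) (a : Fin (n + 1) → K) (a₀ : K) (c : Fin (n + 1) → K),
        (∀ i, a i ∈ k) ∧ a₀ ∈ k ∧
        (∀ b : Fin (n + 1) → K, (∀ i, b i ∈ E) → ∑ i, b i * a i = 0 → ∀ i, b i = 0) ∧
        (∀ i, c i ∈ E) ∧ a₀ = ∑ i, c i * a i ∧ e = c 0}

/-- `λ(k)`: the subfield of `E` generated by the λ-values of `k`. -/
def lambdaSubfield {K : Type*} [Field K] (E k : Subfield K) : Subfield K :=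
  Subfield.closure (lambdaSet E k)

/-- A tuple `x` of elements of `K` is algebraically independent over a subfield `F`:
no nonzero polynomial with coefficients in `F` vanishes at `x`. -/
def AlgIndepOver {K : Type*} [Field K] (F : Subfield K) {m : ℕ} (x : Fin m → K) : Prop :=
  ∀ p : MvPolynomial (Fin m) K, (∀ d, coeff d p ∈ F) → MvPolynomial.eval x p = 0 → p = 0

/-- The subfields `B` and `C` of `K` are algebraically free over `A`: every finite tuple
from `B` which is algebraically independent over `A` remains algebraically independent
over the compositum `A·C`. -/
def AlgFree {K : Type*} [Field K] (A B C : Subfield K) : Prop :=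
  ∀ (m : ℕ) (x : Fin m → K), (∀ i, x i ∈ B) → AlgIndepOver A x → AlgIndepOver (A ⊔ C) x

/-- An element `e` of `K` is algebraic over the subfield `F`. -/
def AlgebraicOver {K : Type*} [Field K] (F : Subfield K) (e : K) : Prop :=
  ∃ p : Polynomial K, p ≠ 0 ∧ (∀ i, p.coeff i ∈ F) ∧ Polynomial.eval e p = 0

/-- The subfield of `K` generated by a subfield `k` and the entries of a tuple `a`. -/
def adjoinTuple {K : Type*} [Field K] (k : Subfield K) {n : ℕ} (a : Fin n → K) :
    Subfield K :=
  Subfield.closure (↑k ∪ Set.range a)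

/-- A nontrivial algebra of finite type over an algebraically closed field has a rational point. -/
theorem exists_algHom_of_finiteType_of_isAlgClosed (F R : Type*) [Field F] [IsAlgClosed F]
    [CommRing R] [Nontrivial R] [Algebra F R] [Algebra.FiniteType F R] : Nonempty (R →ₐ[F] F) := by
  obtain ⟨m, hm⟩ := Ideal.exists_maximal R
  let := Ideal.Quotient.field m
  have := finite_of_finite_type_of_isJacobsonRing F (R ⧸ m)
  have hb := IsAlgClosed.algebraMap_bijective_of_isIntegral (k := F) (K := R ⧸ m)
  exact ⟨((AlgEquiv.ofBijective (Algebra.ofId F (R ⧸ m)) hb).symm : R ⧸ m →ₐ[F] F).comp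
    (Ideal.Quotient.mkₐ F m)⟩

theorem algebraicOver_iff_isAlgebraic {K : Type*} [Field K] {F : Subfield K} {e : K} :
    AlgebraicOver F e ↔ IsAlgebraic F e := by
  constructor
  · rintro ⟨p, hp, hc, he⟩
    obtain ⟨q, rfl⟩ : ∃ q : Polynomial F, q.map (algebraMap F K) = p := by
      have : p ∈ Polynomial.lifts (algebraMap F K) := by
        rw [Polynomial.lifts_iff_coeff_lifts]
        exact fun i => ⟨⟨_, hc i⟩, rfl⟩
      simpa [Polynomial.mem_lifts] using this
    refine ⟨q, by rintro rfl; simp at hp, ?_⟩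
    rwa [Polynomial.aeval_def, Polynomial.eval₂_eq_eval_map]
  · rintro ⟨p, hp, he⟩
    refine ⟨p.map (algebraMap F K), (Polynomial.map_ne_zero_iff (algebraMap F K).injective).2 hp,
      fun i => ?_, ?_⟩
    · rw [Polynomial.coeff_map]; exact (p.coeff i).2
    · rwa [Polynomial.aeval_def, Polynomial.eval₂_eq_eval_map] at he

theorem AlgebraicOver.mono {K : Type*} [Field K] {F G : Subfield K} (h : F ≤ G) {e : K}
    (he : AlgebraicOver F e) : AlgebraicOver G e := by
  obtain ⟨p, hp, hc, he⟩ := he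
  exact ⟨p, hp, fun i => h (hc i), he⟩

theorem AlgIndepOver.mono {K : Type*} [Field K] {F G : Subfield K} (h : F ≤ G) {m : ℕ}
    {x : Fin m → K} (hx : AlgIndepOver G x) : AlgIndepOver F x :=
  fun p hp => hx p fun d => h (hp d)

theorem algIndepOver_iff_algebraicIndependent {K : Type*} [Field K] {F : Subfield K} {m : ℕ}
    {x : Fin m → K} : AlgIndepOver F x ↔ AlgebraicIndependent F x := by
  have hev (q : MvPolynomial (Fin m) F) : eval x (map (algebraMap F K) q) = aeval x q := by
    rw [eval_map, aeval_def]
  rw [algebraicIndependent_iff]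
  constructor
  · intro h q hq
    refine map_injective _ (algebraMap F K).injective ?_
    rw [map_zero]
    refine h _ (fun d => ?_) (by rwa [hev])
    rw [coeff_map]; exact (q.coeff d).2
  · intro h p hp he
    obtain ⟨q, rfl⟩ : p ∈ Set.range (map (σ := Fin m) (algebraMap F K)) := by
      rw [mem_range_map_iff_coeffs_subset]
      rintro _ hc
      obtain ⟨d, -, rfl⟩ := mem_coeffs_iff.1 hc
      exact ⟨⟨_, hp d⟩, rfl⟩
    rw [h q (by rwa [hev] at he), map_zero]

section LinearDisjoint

variable {F K : Type*} [Field F] [Field K] [Algebra F K] {E A B : IntermediateField F K}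

open IntermediateField
open scoped IntermediateField.algebraAdjoinAdjoin

theorem LinearIndependent.adjoin_of_algebraAdjoin {s : Set K} {ι : Type*} {v : ι → K}
    (h : LinearIndependent (Algebra.adjoin F s) v) : LinearIndependent (adjoin F s) v := by
  have : IsScalarTower (Algebra.adjoin F s) (adjoin F s) K := .of_algebraMap_eq fun _ => rfl
  exact (LinearIndependent.iff_fractionRing _ _).1 h

theorem Subalgebra.LinearDisjoint.exists_algHom {R S : Subalgebra F K}
    (H : S.LinearDisjoint R) (ψ : R →ₐ[F] F) :
    ∃ (T : Subalgebra F K) (hS : S ≤ T) (hR : R ≤ T) (φ : T →ₐ[F] S),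
      (∀ x : S, φ ⟨x, hS x.2⟩ = x) ∧ ∀ r : R, φ ⟨r, hR r.2⟩ = algebraMap F S (ψ r) := by
  refine ⟨S ⊔ R, le_sup_left, le_sup_right,
    (Algebra.TensorProduct.lift (AlgHom.id F S) ((Algebra.ofId F S).comp ψ)
      fun _ _ => Commute.all _ _).comp (H.mulMap.symm : _ →ₐ[F] _), fun x => ?_, fun r => ?_⟩
  · have : (⟨x, (le_sup_left : S ≤ S ⊔ R) x.2⟩ : ↥(S ⊔ R)) = H.mulMap (x ⊗ₜ[F] 1) :=
      Subtype.ext (mul_one _).symm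
    rw [this]
    simp
  · have : (⟨r, (le_sup_right : R ≤ S ⊔ R) r.2⟩ : ↥(S ⊔ R)) = H.mulMap (1 ⊗ₜ[F] r) :=
      Subtype.ext (one_mul _).symm
    rw [this]
    simp [Algebra.ofId_apply]

/-- An `F`-point of `R` specialises linear relations with coefficients in `R` between elements
that are algebraic over a field linearly disjoint from `R`. -/
theorem Subalgebra.LinearDisjoint.sum_smul_eq_zero {R : Subalgebra F K}
    (H : A.toSubalgebra.LinearDisjoint R) (ψ : R →ₐ[F] F) (hB : ∀ x ∈ B, IsAlgebraic A x)
    {ι : Type*} [Fintype ι] (r : ι → R) (b : ι → B) (h : ∑ i, (r i : K) * b i = 0) :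
    ∑ i, ψ (r i) • b i = 0 := by
  obtain ⟨S, hAS, hRS, φ, hφA, hφR⟩ := H.exists_algHom ψ
  have hmax : (RingHom.ker φ).IsMaximal :=
    RingHom.ker_isMaximal_of_surjective (K := A) (φ : S →ₐ[F] A) fun x => ⟨_, hφA x⟩
  obtain ⟨Q, hQ, hQφ⟩ := Ideal.exists_ideal_over_maximal_of_isIntegral
    (S := integralClosure S K) (RingHom.ker φ) (by
      intro x hx
      have : x = 0 := Subtype.ext (congrArg (algebraMap _ K) hx)
      rw [this]
      exact zero_mem _)
  have hint (x : B) : (x : K) ∈ integralClosure S K := by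
    obtain ⟨p, hp, hx⟩ := (hB x x.2).isIntegral
    refine ⟨p.map (Subalgebra.inclusion hAS).toRingHom, hp.map _, ?_⟩
    rw [Polynomial.eval₂_map]
    exact hx
  let j : B →+* integralClosure S K :=
    { toFun x := ⟨x, hint x⟩
      map_one' := rfl
      map_mul' _ _ := rfl
      map_zero' := rfl
      map_add' _ _ := rfl }
  have hψ (i : ι) : algebraMap S (integralClosure S K) ⟨r i, hRS (r i).2⟩ -
      algebraMap S (integralClosure S K) (algebraMap F S (ψ (r i))) ∈ Q := by
    rw [← map_sub, ← Ideal.mem_comap, hQφ, RingHom.mem_ker, map_sub, hφR (r i),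
      AlgHom.commutes, sub_self]
  apply ((Ideal.Quotient.mk Q).comp j).injective
  rw [map_zero, map_sum]
  have h0 : ∑ i, algebraMap S (integralClosure S K) ⟨r i, hRS (r i).2⟩ * j (b i) = 0 := by
    apply Subtype.ext
    rw [AddSubmonoidClass.coe_finsetSum]
    exact h
  have h1 := congrArg (Ideal.Quotient.mk Q) h0
  rw [map_zero, map_sum] at h1
  rw [← h1]
  refine Finset.sum_congr rfl fun i _ => ?_
  rw [map_mul, Ideal.Quotient.eq.2 (hψ i), ← map_mul]
  refine congrArg (Ideal.Quotient.mk Q) (Subtype.ext ?_)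
  exact Algebra.smul_def _ _

/-- Over an algebraically closed field, linear disjointness passes to algebraic extensions. -/
theorem IntermediateField.LinearDisjoint.of_isAlgebraic [IsAlgClosed F] (H : E.LinearDisjoint A)
    (hB : ∀ x ∈ B, IsAlgebraic A x) : E.LinearDisjoint B := by
  obtain ⟨κ, b⟩ := Module.Free.exists_basis F B
  refine of_basis_right b ?_
  rw [linearIndependent_iff']
  intro s g hg j hj
  by_contra hgj
  obtain ⟨R, hfg, hRE, hgR, hgR'⟩ : ∃ R : Subalgebra F K, R.FG ∧ R ≤ E.toSubalgebra ∧
      (∀ i : s, (g i : K) ∈ R) ∧ (g j : K)⁻¹ ∈ R := by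
    classical
    refine ⟨Algebra.adjoin F ((s.image fun i => (g i : K)) ∪ {(g j : K)⁻¹} : Finset K), ⟨_, rfl⟩,
      Algebra.adjoin_le fun x hx => ?_, fun i => Algebra.subset_adjoin ?_,
      Algebra.subset_adjoin (by simp)⟩
    · simp only [Finset.coe_union, Finset.coe_image, Finset.coe_singleton, Set.mem_union,
        Set.mem_image, Set.mem_singleton_iff] at hx
      rcases hx with ⟨i, -, rfl⟩ | rfl
      · exact (g i).2
      · exact E.inv_mem (g j).2
    · simp only [Finset.coe_union, Finset.coe_image]
      exact Or.inl ⟨i, i.2, rfl⟩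
  have : Algebra.FiniteType F R := (Subalgebra.fg_iff_finiteType R).1 hfg
  obtain ⟨ψ⟩ := exists_algHom_of_finiteType_of_isAlgClosed F R
  have key := ((linearDisjoint_iff'.1 H).symm.of_le_right_of_flat hRE).sum_smul_eq_zero ψ hB
    (fun i : s => ⟨g i, hgR i⟩) (fun i => b i) (by rw [← Finset.sum_coe_sort] at hg; exact hg)
  have hψ := Fintype.linearIndependent_iff.1
    (b.linearIndependent.comp ((↑) : s → _) Subtype.val_injective) _ key ⟨j, hj⟩
  have hunit : (⟨g j, hgR ⟨j, hj⟩⟩ : R) * ⟨_, hgR'⟩ = 1 :=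
    Subtype.ext (mul_inv_cancel₀ (by simpa using hgj))
  have := congrArg ψ hunit
  rw [map_mul, map_one] at this
  simp [hψ] at this

theorem Submodule.span_subfield_eq_adjoin (k : Subfield K) :
    Submodule.span F (k : Set K) = Subalgebra.toSubmodule (Algebra.adjoin F (k : Set K)) := by
  rw [Algebra.adjoin_eq_span]
  congr 1
  exact (Submonoid.closure_eq k.toSubmonoid).symm ▸ rfl

theorem AlgebraicIndependent.linearIndependent_algebraAdjoin {M : IntermediateField F K}
    (hA : A ≤ M) {ι κ : Type*} {t : ι → K} (ht : AlgebraicIndependent M t) {v : κ → M}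
    (hv : LinearIndependent A fun i => (v i : K)) :
    LinearIndependent (Algebra.adjoin A (Set.range t)) fun i => (v i : K) := by
  rw [linearIndependent_iff'] at hv ⊢
  intro s g hg
  have hp (i) : ∃ p : MvPolynomial ι A, aeval t p = (g i : K) :=
    (Algebra.adjoin_range_eq_range_aeval A t).le (g i).2
  choose p hp using hp
  let φ : A →+* M := inclusion hA
  have hφ (q : MvPolynomial ι A) : aeval t (MvPolynomial.map φ q) = aeval t q := by
    rw [aeval_def, eval₂_map, aeval_def]; rfl
  have h0 : ∑ i ∈ s, C (v i) * MvPolynomial.map φ (p i) = 0 := by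
    apply ht.eq_zero_of_aeval_eq_zero
    rw [map_sum, ← hg]
    refine Finset.sum_congr rfl fun i _ => ?_
    rw [map_mul, aeval_C, hφ, hp, mul_comm]
    rfl
  intro i hi
  have hpi : p i = 0 := by
    ext d : 1
    have := congrArg (coeff d) h0
    simp only [coeff_sum, coeff_C_mul, coeff_map, coeff_zero] at this
    refine hv s (fun i => coeff d (p i)) ?_ i hi
    have := congrArg (algebraMap M K) this
    rw [map_sum, map_zero] at this
    rw [← this]
    exact Finset.sum_congr rfl fun i _ => mul_comm _ _
  exact Subtype.ext (by rw [← hp, hpi, map_zero]; rfl)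

/-- Linear disjointness passes to the extension generated by elements that are algebraically
independent over the compositum. -/
theorem IntermediateField.LinearDisjoint.adjoin_algebraicIndependent (H : E.LinearDisjoint A)
    {M : IntermediateField F K} (hE : E ≤ M) (hA : A ≤ M) {ι : Type*} {t : ι → K}
    (ht : AlgebraicIndependent M t) :
    E.LinearDisjoint ((adjoin A (Set.range t)).restrictScalars F) := by
  obtain ⟨κ, b⟩ := Module.Free.exists_basis F E
  exact of_basis_left b (ht.linearIndependent_algebraAdjoin hA (v := fun i => inclusion hE (b i))
    (H.linearIndependent_left b.linearIndependent)).adjoin_of_algebraAdjoin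

theorem LinearIndependent.algebraAdjoin_of_smul {R : Type*} [Field R] [Algebra R K] {S : Set K}
    {ι κ : Type*} {v : ι → K} {w : κ → K}
    (hS : Subalgebra.toSubmodule (Algebra.adjoin R S) ≤ Submodule.span R (Set.range w))
    (h : LinearIndependent R fun p : ι × κ => v p.1 * w p.2) :
    LinearIndependent (Algebra.adjoin R S) v := by
  classical
  rw [linearIndependent_iff'] at h ⊢
  intro s g hg
  have hc (i) : ∃ c : κ →₀ R, (c.sum fun j r => r • w j) = (g i : K) :=
    Finsupp.mem_span_range_iff_exists_finsupp.1 (hS (g i).2)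
  choose c hc using hc
  set J := s.biUnion fun i => (c i).support
  have hcJ (i) (hi : i ∈ s) : (g i : K) = ∑ j ∈ J, c i j • w j := by
    rw [← hc]
    exact Finsupp.sum_of_support_subset _
      (Finset.subset_biUnion_of_mem (fun i => (c i).support) hi) _ fun _ _ => zero_smul _ _
  have h0 := h (s ×ˢ J) (fun p => c p.1 p.2) (by
    rw [← hg, Finset.sum_product]
    refine Finset.sum_congr rfl fun i hi => ?_
    rw [Subalgebra.smul_def, smul_eq_mul, hcJ i hi, Finset.sum_mul]
    exact Finset.sum_congr rfl fun j _ => by rw [smul_mul_assoc, mul_comm])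
  intro i hi
  refine Subtype.ext ((hcJ i hi).trans (Finset.sum_eq_zero fun j hj => ?_))
  rw [h0 (i, j) (Finset.mk_mem_product hi hj), zero_smul]

theorem mem_lambdaSet_of_sum {E k : Subfield K} {ι : Type*} [Fintype ι] {y c : ι → K}
    (hy : ∀ i, y i ∈ k) (hli : LinearIndependent E y) (hc : ∀ i, c i ∈ E)
    (hk : ∑ i, c i * y i ∈ k) (i : ι) : c i ∈ lambdaSet E k := by
  obtain ⟨n, hn⟩ : ∃ n, Fintype.card ι = n + 1 :=
    Nat.exists_eq_succ_of_ne_zero (Fintype.card_pos_iff.2 ⟨i⟩).ne'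
  let e₀ := (Fintype.equivFinOfCardEq hn).symm
  let e := (Equiv.swap 0 (e₀.symm i)).trans e₀
  have he : e 0 = i := by simp [e]
  refine ⟨n, y ∘ e, _, c ∘ e, fun j => hy _, hk, fun b hb h j => ?_, fun j => hc _,
    (e.sum_comp fun i => c i * y i).symm, by simp [he]⟩
  exact congrArg Subtype.val
    (Fintype.linearIndependent_iff.1 (hli.comp e e.injective) (fun j => ⟨b j, hb j⟩) h j)

/-- A field whose λ-values lie in `F` is linearly disjoint from `E` over `F`. -/
theorem IntermediateField.linearDisjoint_adjoin_of_lambdaSet_subset {k : Subfield K}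
    (h : lambdaSet E.toSubfield k ⊆ Set.range (algebraMap F K)) :
    E.LinearDisjoint (adjoin F (k : Set K)) := by
  obtain ⟨s, hsk, hspan, hs⟩ := exists_linearIndependent E (k : Set K)
  obtain ⟨κ, b⟩ := Module.Free.exists_basis F E
  have hk : (k : Set K) ⊆ Submodule.span F (Set.range ((↑) : s → K)) := by
    intro x hx
    have hx' : x ∈ Submodule.span E s := hspan ▸ Submodule.subset_span hx
    obtain ⟨c, hcs, rfl⟩ := Submodule.mem_span_set.1 hx'
    refine Submodule.sum_mem _ fun y hy => ?_
    have hc : (c y : K) ∈ lambdaSet E.toSubfield k := by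
      refine mem_lambdaSet_of_sum (ι := {y // y ∈ c.support}) (y := fun y => y.1)
        (c := fun y => (c y.1).1) (fun y => hsk (hcs y.2)) ?_ (fun y => (c y.1).2) ?_ ⟨y, hy⟩
      · exact hs.comp (fun y : {y // y ∈ c.support} => ⟨y, hcs y.2⟩) fun _ _ h =>
          Subtype.ext (Subtype.mk.inj h)
      · rw [Finset.sum_coe_sort c.support fun y => (c y : K) * y]
        exact hx
    obtain ⟨f, hf⟩ := h hc
    have : c y • y = f • y := by
      rw [Algebra.smul_def f, hf]; rfl
    dsimp only
    rw [this]
    exact Submodule.smul_mem _ _ (Submodule.subset_span ⟨⟨y, hcs hy⟩, rfl⟩)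
  have hbs := linearIndependent_smul b.linearIndependent hs
  refine LinearDisjoint.of_basis_left b (LinearIndependent.adjoin_of_algebraAdjoin ?_)
  refine LinearIndependent.algebraAdjoin_of_smul (w := ((↑) : s → K)) ?_ hbs
  exact (Submodule.span_subfield_eq_adjoin k).ge.trans (Submodule.span_le.2 hk)

theorem IntermediateField.LinearDisjoint.lambdaSet_subset (H : E.LinearDisjoint A)
    {k : Subfield K} (hk : k ≤ A.toSubfield) :
    lambdaSet E.toSubfield k ⊆ Set.range (algebraMap F K) := by
  rintro e ⟨n, a, a₀, c, ha, ha₀, hli, hc, rfl, rfl⟩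
  let x : Fin (n + 2) → A := Fin.cons ⟨_, hk ha₀⟩ fun i => ⟨a i, hk (ha i)⟩
  have hx : ¬ LinearIndependent F x := by
    intro hx
    have := Fintype.linearIndependent_iff.1 (H.linearIndependent_right hx)
      (Fin.cons (-1) fun i => ⟨c i, hc i⟩) (by
        rw [Fin.sum_univ_succ]
        simp [x, IntermediateField.smul_def]) 0
    simp at this
  obtain ⟨g, hg, i, hi⟩ := Fintype.not_linearIndependent_iff.1 hx
  have hg' : ∑ i, (algebraMap F K (g 0) * c i + algebraMap F K (g i.succ)) * a i = 0 := by
    have := congrArg (algebraMap A K) hg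
    rw [Fin.sum_univ_succ] at this
    simp only [x, Fin.cons_zero, Fin.cons_succ, map_add, map_sum, map_zero, Algebra.smul_def,
      map_mul] at this
    simp only [add_mul, Finset.sum_add_distrib, mul_assoc, ← Finset.mul_sum]
    exact this
  have hz := hli _ (fun i => E.add_mem (E.mul_mem (E.algebraMap_mem _) (hc i))
    (E.algebraMap_mem _)) hg'
  have hg0 : g 0 ≠ 0 := by
    intro h0
    refine hi ?_
    cases i using Fin.cases with
    | zero => exact h0
    | succ i => simpa [h0] using hz i
  refine ⟨-g 1 / g 0, ?_⟩
  have h1 : algebraMap F K (g 0) ≠ 0 := by simpa using hg0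
  rw [map_div₀, div_eq_iff h1, map_neg, ← Fin.succ_zero_eq_one]
  linear_combination -hz 0

theorem IntermediateField.LinearDisjoint.linearIndependent_adjoin {C C' : IntermediateField F K}
    (H : E.LinearDisjoint C') (hC : C ≤ C') {ι : Type*} {x : ι → C'}
    (hx : LinearIndependent C fun i => (x i : K)) :
    LinearIndependent (adjoin C (E : Set K)) fun i => (x i : K) := by
  let : Algebra C C' := (inclusion hC).toAlgebra
  have : IsScalarTower C C' K := .of_algebraMap_eq fun _ => rfl
  obtain ⟨κ, b⟩ := Module.Free.exists_basis F E
  have hx' : LinearIndependent C x :=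
    LinearIndependent.of_comp (IsScalarTower.toAlgHom C C' K).toLinearMap hx
  have hxb := linearIndependent_smul hx' (H.linearIndependent_left b.linearIndependent)
  have hEb : (E : Set K) ⊆ Submodule.span F (Set.range fun i => (b i : K)) := by
    intro y hy
    have := Submodule.mem_map_of_mem (f := E.val.toLinearMap) (b.mem_span ⟨y, hy⟩)
    rw [Submodule.map_span, ← Set.range_comp] at this
    exact this
  refine LinearIndependent.adjoin_of_algebraAdjoin ?_
  refine LinearIndependent.algebraAdjoin_of_smul (w := fun i => (b i : K)) ?_ hxb
  refine (Submodule.span_subfield_eq_adjoin (F := C) E.toSubfield).ge.trans ?_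
  refine Submodule.span_le.2 fun y hy => ?_
  exact Submodule.span_le_restrictScalars F C _ (hEb hy)

theorem linearIndependent_pow_iff_transcendental {R A : Type*} [CommRing R] [CommRing A]
    [Algebra R A] {u : A} : LinearIndependent R (fun i : ℕ => u ^ i) ↔ Transcendental R u := by
  have h := Polynomial.linearIndependent_powers_iff_aeval (Algebra.lmul R A u) 1
  simp only [← map_pow, Polynomial.aeval_algHom_apply] at h
  simpa [transcendental_iff] using h

/-- If `C'` is linearly disjoint from `E`, an element of `C'` that is algebraic over the
compositum of `E` with a subfield `C ≤ C'` is algebraic over `C`. -/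
theorem IntermediateField.LinearDisjoint.isAlgebraic_of_adjoin {C C' : IntermediateField F K}
    (H : E.LinearDisjoint C') (hC : C ≤ C') {u : K} (hu : u ∈ C')
    (h : IsAlgebraic (adjoin C (E : Set K)) u) : IsAlgebraic C u := by
  by_contra hn
  let x : ℕ → C' := fun i => (⟨u, hu⟩ : C') ^ i
  have hx : (fun i => (x i : K)) = fun i => u ^ i := rfl
  have h1 := H.linearIndependent_adjoin hC (x := x)
    (hx ▸ linearIndependent_pow_iff_transcendental.2 hn)
  rw [hx] at h1
  exact linearIndependent_pow_iff_transcendental.1 h1 h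

end LinearDisjoint

theorem lambdaSet_mono {K : Type*} [Field K] {E k L : Subfield K} (h : k ≤ L) :
    lambdaSet E k ⊆ lambdaSet E L := by
  rintro e ⟨n, a, a₀, c, ha, ha₀, hli⟩
  exact ⟨n, a, a₀, c, fun i => h (ha i), h ha₀, hli⟩

theorem adjoinTuple_mono {K : Type*} [Field K] {k L : Subfield K} (h : k ≤ L) {n : ℕ}
    (a : Fin n → K) : adjoinTuple k a ≤ adjoinTuple L a :=
  Subfield.closure_mono (Set.union_subset_union_left _ h)

theorem AlgFree.exists_subset_algebraicIndependent {K : Type*} [Field K] {P B Q : Subfield K}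
    (h : AlgFree P B Q) {X : Set K} (hX : X.Finite) (hXB : X ⊆ B) :
    ∃ s ⊆ X, AlgebraicIndependent ↥(P ⊔ Q) ((↑) : s → K) ∧
      ∀ S : Subfield K, P ≤ S → s ⊆ S → ∀ x ∈ X, IsAlgebraic S x := by
  obtain ⟨s, -, hs⟩ := exists_maximal_algebraicIndependent (R := P) ∅ X (Set.empty_subset _)
    (algebraicIndependent_empty_type_iff.2 (algebraMap P K).injective)
  have hsX : s ⊆ X := hs.prop.2
  refine ⟨s, hsX, ?_, fun S hPS hsS x hx => ?_⟩
  · have := (hX.subset hsX).to_subtype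
    obtain ⟨m, ⟨e⟩⟩ := Finite.exists_equiv_fin s
    have h1 := h m (fun i => e.symm i) (fun i => hXB (hsX (e.symm i).2))
      (algIndepOver_iff_algebraicIndependent.2 (hs.prop.1.comp e.symm e.symm.injective))
    have h2 := (algIndepOver_iff_algebraicIndependent.1 h1).comp e e.injective
    simpa [Function.comp_def] using h2
  · have halg : IsAlgebraic (Algebra.adjoin P s) x := by
      by_contra hn
      have hins := hs.prop.1.insert (i := x) (by rwa [Set.image_id])
      have hxs : x ∈ s := hs.le_of_ge ⟨hins, Set.insert_subset hx hsX⟩ (Set.subset_insert x s)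
        (Set.mem_insert x s)
      exact hn (isAlgebraic_algebraMap (⟨x, Algebra.subset_adjoin hxs⟩ : Algebra.adjoin P s))
    have hle : (Algebra.adjoin P s).toSubring ≤ S.toSubring := by
      rw [Algebra.adjoin_eq_ring_closure, Subring.closure_le]
      rintro _ (⟨y, rfl⟩ | hy)
      · exact hPS y.2
      · exact hsS hy
    obtain ⟨p, hp, hpx⟩ := halg
    refine algebraicOver_iff_isAlgebraic.1 ⟨p.map (algebraMap _ K),
      (Polynomial.map_ne_zero_iff Subtype.val_injective).2 hp, fun i => ?_, ?_⟩
    · rw [Polynomial.coeff_map]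
      exact hle (p.coeff i).2
    · rwa [Polynomial.aeval_def, Polynomial.eval₂_eq_eval_map] at hpx

section LinearDisjoint

variable {F K : Type*} [Field F] [Field K] [Algebra F K] {E : IntermediateField F K}

open IntermediateField

theorem lambdaSet_adjoinTuple_subset [IsAlgClosed F] {k L : Subfield K} (hkL : k ≤ L) {n : ℕ}
    {a : Fin n → K} (hfree : AlgFree (E.toSubfield ⊔ k) (adjoinTuple k a) (E.toSubfield ⊔ L))
    (hL : lambdaSet E.toSubfield L ⊆ Set.range (algebraMap F K))
    (hka : lambdaSet E.toSubfield (adjoinTuple k a) ⊆ Set.range (algebraMap F K)) :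
    lambdaSet E.toSubfield (adjoinTuple L a) ⊆ Set.range (algebraMap F K) := by
  have hAL := linearDisjoint_adjoin_of_lambdaSet_subset hL
  have hCk := linearDisjoint_adjoin_of_lambdaSet_subset hka
  have hak : Set.range a ⊆ adjoinTuple k a :=
    Set.subset_union_right.trans Subfield.subset_closure
  have hkk : k ≤ adjoinTuple k a :=
    Set.subset_union_left.trans Subfield.subset_closure
  obtain ⟨s, hsa, hs, halg⟩ := hfree.exists_subset_algebraicIndependent (Set.finite_range a) hak
  let A₁ := (adjoin (adjoin F (L : Set K)) (Set.range ((↑) : s → K))).restrictScalars F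
  have hLA : adjoin F (L : Set K) ≤ A₁ := fun x hx =>
    IntermediateField.algebraMap_mem _ (⟨x, hx⟩ : adjoin F (L : Set K))
  have hsA : s ⊆ A₁ := by
    have := subset_adjoin (adjoin F (L : Set K)) (Set.range ((↑) : s → K))
    exact Subtype.range_coe.ge.trans this
  have hA₁ : E.LinearDisjoint A₁ := by
    let M : IntermediateField F K := Subfield.toIntermediateField
      (E.toSubfield ⊔ k ⊔ (E.toSubfield ⊔ L)) fun x =>
        (le_sup_left.trans le_sup_left : E.toSubfield ≤ _) (E.algebraMap_mem x)
    have hEM : E ≤ M := (le_sup_left.trans le_sup_left : E.toSubfield ≤ _)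
    have hLM : adjoin F (L : Set K) ≤ M :=
      adjoin_le_iff.2 (le_sup_right.trans le_sup_right : L ≤ _)
    exact hAL.adjoin_algebraicIndependent hEM hLM (M := M) hs
  have ha₁ (x) (hx : x ∈ Set.range a) : IsAlgebraic A₁ x := by
    let C := adjoin F ((k : Set K) ∪ s)
    have hkC : (k : Set K) ∪ s ⊆ C := subset_adjoin F _
    have hC : C ≤ adjoin F (adjoinTuple k a : Set K) :=
      adjoin.mono _ _ _ (Set.union_subset hkk (hsa.trans hak))
    have hCA : C ≤ A₁ :=
      adjoin_le_iff.2 (Set.union_subset (fun y hy => hLA (subset_adjoin F _ (hkL hy))) hsA)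
    have hCE (y) (hy : y ∈ C) : y ∈ adjoin C (E : Set K) :=
      IntermediateField.algebraMap_mem _ (⟨y, hy⟩ : C)
    have h1 : IsAlgebraic (adjoin C (E : Set K)) x :=
      halg (adjoin C (E : Set K)).toSubfield
        (sup_le (subset_adjoin C (E : Set K)) fun y hy => hCE y (hkC (Or.inl hy)))
        (fun y hy => hCE y (hkC (Or.inr hy))) x hx
    have h2 : IsAlgebraic C x := hCk.isAlgebraic_of_adjoin hC (subset_adjoin F _ (hak hx)) h1
    exact algebraicOver_iff_isAlgebraic.1
      ((algebraicOver_iff_isAlgebraic (F := C.toSubfield).2 h2).mono (G := A₁.toSubfield) hCA)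
  have hB := hA₁.of_isAlgebraic (B := (algebraicClosure A₁ K).restrictScalars F)
    fun x hx => mem_algebraicClosure_iff.1 hx
  refine hB.lambdaSet_subset (Subfield.closure_le.2 (Set.union_subset (fun y hy => ?_) ?_))
  · exact IntermediateField.algebraMap_mem (algebraicClosure A₁ K)
      (⟨y, hLA (subset_adjoin F _ hy)⟩ : A₁)
  · exact fun y hy => mem_algebraicClosure_iff.2 (ha₁ y hy)

end LinearDisjoint

/-- Let `E ⊊ K` be a proper pair of algebraically closed fields,
`k ⊆ L` subfields of `K` and `a` a finite tuple from `K`. If the field `k(a)` and the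
compositum `E·L` are algebraically free over the compositum `E·k`, then
`λ(k(a)) ⊆ λ(L(a))` and every element of `λ(L(a))` is algebraic over the compositum
`λ(L)·λ(k(a))`. -/
theorem lambda_interalgebraic {K : Type*} [Field K] [IsAlgClosed K]
    (E : Subfield K) (hE : IsAlgClosed E) (hEproper : E ≠ ⊤)
    (k L : Subfield K) (hkL : k ≤ L) (n : ℕ) (a : Fin n → K)
    (hfree : AlgFree (E ⊔ k) (adjoinTuple k a) (E ⊔ L)) :
    lambdaSubfield E (adjoinTuple k a) ≤ lambdaSubfield E (adjoinTuple L a) ∧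
    ∀ e ∈ lambdaSubfield E (adjoinTuple L a),
      AlgebraicOver (lambdaSubfield E L ⊔ lambdaSubfield E (adjoinTuple k a)) e := by
  refine ⟨Subfield.closure_mono (lambdaSet_mono (adjoinTuple_mono hkL a)), ?_⟩
  let G := lambdaSubfield E L ⊔ lambdaSubfield E (adjoinTuple k a)
  have hlE (k : Subfield K) : lambdaSubfield E k ≤ E := by
    refine Subfield.closure_le.2 ?_
    rintro _ ⟨n, a, a₀, c, -, -, -, hc, -, rfl⟩
    exact hc 0
  have hGE : G ≤ E := sup_le (hlE L) (hlE _)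
  have hmem {e : K} : e ∈ algebraicClosure G K ↔ AlgebraicOver G e :=
    mem_algebraicClosure_iff.trans algebraicOver_iff_isAlgebraic.symm
  have hrange : Set.range (algebraMap (algebraicClosure G K) K) = algebraicClosure G K :=
    Subtype.range_coe
  have hFE (x : algebraicClosure G K) : algebraMap (algebraicClosure G K) K x ∈ E := by
    have hx : (x : K) ∈ algebraicClosure E K :=
      mem_algebraicClosure_iff.2 (algebraicOver_iff_isAlgebraic.1 ((hmem.1 x.2).mono hGE))
    rw [(IsAlgClosed.algebraicClosure_eq_bot_iff E K).2 hE] at hx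
    obtain ⟨y, hy⟩ := IntermediateField.mem_bot.1 hx
    change (x : K) ∈ E
    exact hy ▸ y.2
  have hclosed : IsAlgClosed (algebraicClosure G K) :=
    (algebraicClosure.isAlgClosure G K).isAlgClosed
  have hGF : (G : Set K) ⊆ Set.range (algebraMap (algebraicClosure G K) K) := by
    rw [hrange]
    exact fun x hx => IntermediateField.algebraMap_mem _ (⟨x, hx⟩ : G)
  have key := lambdaSet_adjoinTuple_subset (E := E.toIntermediateField hFE) hkL hfree
    (Set.Subset.trans (Subfield.subset_closure.trans (le_sup_left : _ ≤ G)) hGF)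
    (Set.Subset.trans (Subfield.subset_closure.trans (le_sup_right : _ ≤ G)) hGF)
  rw [hrange] at key
  exact fun e he => hmem.1 (Subfield.closure_le (t := (algebraicClosure G K).toSubfield).2 key he)
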